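/- arXiv:1709.03331 — 11 statements merged into one kernel-verified Lean document; each statement's English description precedes it below -/
import Mathlib

section
/- Let G be a simple graph and let V1 = ⋃_{j=1}^k W_{1,j} and V2 = ⋃_{j=1}^k W_{2,j}, where the W_{1,j} are the vertex sets of the connected components of the subgraph induced by V1 and the W_{2,j} are the vertex sets of the connected components of the subgraph induced by V2. If for each j the sets W_{1,j} and W_{2,j} are F-twins via a bijection φ_j : W_{1,j} → W_{2,j}, then V1 and V2 are F-twins via the common extension φ of the maps φ_j. -/
/-- `V1` and `V2` (as vertex sets of induced subgraphs of `G`) are F-twins via the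
bijection `φ : V1 → V2`: `φ` is an isomorphism of the induced subgraphs and every
`u ∈ V1` satisfies `N(u) \ V1 = N(φ u) \ V2`. -/
def SimpleGraph.IsFTwinVia {V : Type*} (G : SimpleGraph V) (V1 V2 : Set V) (φ : V → V) : Prop :=
  Set.BijOn φ V1 V2 ∧
  (∀ u ∈ V1, ∀ v ∈ V1, (G.Adj u v ↔ G.Adj (φ u) (φ v))) ∧
  (∀ u ∈ V1, G.neighborSet u \ V1 = G.neighborSet (φ u) \ V2)

/-- `V1` and `V2` are F-twins. -/
def SimpleGraph.FTwins {V : Type*} (G : SimpleGraph V) (V1 V2 : Set V) : Prop :=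
  ∃ φ : V → V, G.IsFTwinVia V1 V2 φ
/-- `W` is the vertex set of a connected component of the subgraph of `G` induced by `S`. -/
def SimpleGraph.IsCompOf {V : Type*} (G : SimpleGraph V) (S W : Set V) : Prop :=
  ∃ C : (G.induce S).ConnectedComponent, W = Subtype.val '' C.supp

theorem SimpleGraph.IsCompOf.subset {V : Type*} {G : SimpleGraph V} {S W : Set V}
    (h : G.IsCompOf S W) : W ⊆ S := by
  obtain ⟨C, rfl⟩ := h
  rintro _ ⟨x, -, rfl⟩
  exact x.2

theorem SimpleGraph.IsCompOf.mem_of_adj {V : Type*} {G : SimpleGraph V} {S W : Set V}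
    (h : G.IsCompOf S W) {u v : V} (hu : u ∈ W) (hv : v ∈ S) (huv : G.Adj u v) : v ∈ W := by
  obtain ⟨C, rfl⟩ := h
  obtain ⟨x, hx, rfl⟩ := hu
  have hadj : (G.induce S).Adj x ⟨v, hv⟩ := huv
  exact ⟨⟨v, hv⟩, (C.mem_supp_congr_adj hadj).1 hx, rfl⟩

theorem SimpleGraph.IsCompOf.eq_of_mem {V : Type*} {G : SimpleGraph V} {S W W' : Set V}
    (h : G.IsCompOf S W) (h' : G.IsCompOf S W') {x : V} (hx : x ∈ W) (hx' : x ∈ W') :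
    W = W' := by
  obtain ⟨C, rfl⟩ := h
  obtain ⟨D, rfl⟩ := h'
  obtain ⟨y, hy, rfl⟩ := hx
  obtain ⟨z, hz, hzy⟩ := hx'
  obtain rfl : z = y := Subtype.ext hzy
  rw [SimpleGraph.ConnectedComponent.mem_supp_iff] at hy hz
  rw [← hy, ← hz]

theorem SimpleGraph.IsCompOf.neighborSet_diff {V : Type*} {G : SimpleGraph V} {S W : Set V}
    (h : G.IsCompOf S W) {u : V} (hu : u ∈ W) :
    G.neighborSet u \ S = G.neighborSet u \ W := by
  ext v
  exact and_congr_right fun huv =>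
    not_congr ⟨fun hv => h.mem_of_adj hu hv huv, fun hv => h.subset hv⟩

/-- If `V1` and `V2` decompose as unions of the vertex sets of the connected components
of the subgraphs they induce, and these components can be matched as F-twin pairs via
(the restrictions of) a common map `φ`, then `V1` and `V2` are F-twins via `φ`. -/
theorem ftwin_of_components {V ι : Type*} (G : SimpleGraph V) (V1 V2 : Set V)
    (W1 W2 : ι → Set V) (φ : V → V)
    (hW1inj : Function.Injective W1) (hW2inj : Function.Injective W2)
    (hW1comp : ∀ j, G.IsCompOf V1 (W1 j)) (hW2comp : ∀ j, G.IsCompOf V2 (W2 j))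
    (hV1 : V1 = ⋃ j, W1 j) (hV2 : V2 = ⋃ j, W2 j)
    (htwin : ∀ j, G.IsFTwinVia (W1 j) (W2 j) φ) :
    G.IsFTwinVia V1 V2 φ := by
  have mem1 : ∀ u ∈ V1, ∃ j, u ∈ W1 j := fun u hu => Set.mem_iUnion.1 (hV1 ▸ hu)
  have mem2 : ∀ u ∈ V2, ∃ j, u ∈ W2 j := fun u hu => Set.mem_iUnion.1 (hV2 ▸ hu)
  have maps : ∀ {j u}, u ∈ W1 j → φ u ∈ W2 j := fun {j u} hu => (htwin j).1.mapsTo hu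
  have index_eq : ∀ {i j x}, x ∈ W2 i → x ∈ W2 j → i = j := fun {i j x} hi hj =>
    hW2inj ((hW2comp i).eq_of_mem (hW2comp j) hi hj)
  refine ⟨⟨?_, ?_, ?_⟩, ?_, ?_⟩
  · intro u hu
    obtain ⟨j, hj⟩ := mem1 u hu
    exact (hW2comp j).subset (maps hj)
  · intro u hu v hv huv
    obtain ⟨i, hi⟩ := mem1 u hu
    obtain ⟨j, hj⟩ := mem1 v hv
    obtain rfl : i = j := index_eq (maps hi) (huv ▸ maps hj)
    exact (htwin i).1.injOn hi hj huv
  · intro w hw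
    obtain ⟨j, hj⟩ := mem2 w hw
    obtain ⟨u, hu, rfl⟩ := (htwin j).1.surjOn hj
    exact ⟨u, (hW1comp j).subset hu, rfl⟩
  · intro u hu v hv
    obtain ⟨i, hi⟩ := mem1 u hu
    obtain ⟨j, hj⟩ := mem1 v hv
    constructor
    · intro huv
      exact ((htwin i).2.1 u hi v ((hW1comp i).mem_of_adj hi hv huv)).1 huv
    · intro huv
      obtain rfl : i = j := index_eq
        ((hW2comp i).mem_of_adj (maps hi) ((hW2comp j).subset (maps hj)) huv) (maps hj)
      exact ((htwin i).2.1 u hi v hj).2 huv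
  · intro u hu
    obtain ⟨j, hj⟩ := mem1 u hu
    rw [(hW1comp j).neighborSet_diff hj, (hW2comp j).neighborSet_diff (maps hj)]
    exact (htwin j).2.2 u hj
end

section
/- Let G be a simple graph and let V1, V2 be vertex sets of induced subgraphs of G that are proper F-twins (F-twins with V1 ≠ V2). If w ∈ V1 ∩ V2, then the connected component of the subgraph induced by V1 containing w and the connected component of the subgraph induced by V2 containing w have the same vertex set, and this vertex set is contained in V1 ∩ V2. -/
/-- The vertex set of the connected component containing `w` of the subgraph of `G`
induced by `S`. -/
def SimpleGraph.compSuppOf {V : Type*} (G : SimpleGraph V) (S : Set V) (w : V) : Set V :=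
  {x | ∃ (hx : x ∈ S) (hw : w ∈ S), (G.induce S).Reachable ⟨x, hx⟩ ⟨w, hw⟩}

/-- F-twins admit no edge from their intersection to the rest of the first set. -/
theorem SimpleGraph.FTwins.mem_right_of_adj {V : Type*} {G : SimpleGraph V} {V1 V2 : Set V}
    (h : G.FTwins V1 V2) {a b : V} (ha : a ∈ V2) (hb : b ∈ V1) (hab : G.Adj a b) : b ∈ V2 := by
  obtain ⟨φ, hφ, -, hN⟩ := h
  obtain ⟨x, hx, rfl⟩ := hφ.surjOn ha
  by_contra hb2
  have hmem : b ∈ G.neighborSet x \ V1 := by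
    rw [hN x hx]
    exact ⟨hab, hb2⟩
  exact hmem.2 hb

/-- F-twins admit no edge from their intersection to the rest of the second set. -/
theorem SimpleGraph.FTwins.mem_left_of_adj {V : Type*} {G : SimpleGraph V} {V1 V2 : Set V}
    (h : G.FTwins V1 V2) {a b : V} (ha : a ∈ V1) (hb : b ∈ V2) (hab : G.Adj a b) : b ∈ V1 := by
  obtain ⟨φ, -, -, hN⟩ := h
  by_contra hb1
  have hmem : b ∈ G.neighborSet (φ a) \ V2 := by
    rw [← hN a ha]
    exact ⟨hab, hb1⟩
  exact hmem.2 hb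

theorem SimpleGraph.compSuppOf_subset {V : Type*} (G : SimpleGraph V) (S : Set V) (w : V) :
    G.compSuppOf S w ⊆ S :=
  fun _ ⟨hx, _⟩ => hx

/-- If no edge of `G` joins `T` to a vertex of `S` outside `T`, then for `w ∈ T` the component
of `w` in `S` is contained in the component of `w` in `T`. -/
theorem SimpleGraph.compSuppOf_subset_compSuppOf {V : Type*} {G : SimpleGraph V} {S T : Set V}
    (hST : ∀ ⦃a b⦄, a ∈ T → b ∈ S → G.Adj a b → b ∈ T) {w : V} (hw : w ∈ T) :
    G.compSuppOf S w ⊆ G.compSuppOf T w := by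
  rintro x ⟨hx, hwS, ⟨p⟩⟩
  suffices key : ∀ {y z : S}, (G.induce S).Walk y z → z.1 ∈ T → y.1 ∈ G.compSuppOf T z.1 from
    key p hw
  intro y z p hz
  induction p with
  | nil => exact ⟨hz, hz, .rfl⟩
  | @cons u v z huv _ ih =>
    obtain ⟨hv, hz', hr⟩ := ih hz
    have huv' : G.Adj u.1 v.1 := huv
    have hu : u.1 ∈ T := hST hv u.2 huv'.symm
    have hadj : (G.induce T).Adj ⟨u.1, hu⟩ ⟨v.1, hv⟩ := huv'
    exact ⟨hu, hz', hadj.reachable.trans hr⟩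

/-- If `V1` and `V2` are proper F-twins and `w ∈ V1 ∩ V2`, then the connected component
of the subgraph induced by `V1` containing `w` and the connected component of the
subgraph induced by `V2` containing `w` have the same vertex set, and this vertex set
is contained in `V1 ∩ V2`. -/
theorem ftwin_inter_components {V : Type*} (G : SimpleGraph V) (V1 V2 : Set V)
    (h : G.FTwins V1 V2) (hne : V1 ≠ V2) (w : V) (hw : w ∈ V1 ∩ V2) :
    G.compSuppOf V1 w = G.compSuppOf V2 w ∧ G.compSuppOf V1 w ⊆ V1 ∩ V2 := by
  have h12 : G.compSuppOf V1 w ⊆ G.compSuppOf V2 w :=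
    SimpleGraph.compSuppOf_subset_compSuppOf (fun _ _ => h.mem_right_of_adj) hw.2
  have h21 : G.compSuppOf V2 w ⊆ G.compSuppOf V1 w :=
    SimpleGraph.compSuppOf_subset_compSuppOf (fun _ _ => h.mem_left_of_adj) hw.1
  exact ⟨h12.antisymm h21,
    Set.subset_inter (G.compSuppOf_subset V1 w) (h12.trans (G.compSuppOf_subset V2 w))⟩
end

section
/- Let G be a simple graph and let V1, V2 be vertex sets of induced subgraphs of G that are proper F-twins (F-twins with V1 ≠ V2). If the subgraphs induced by V1 and by V2 are both connected, then V1 ∩ V2 = ∅. -/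
/-- If `G.induce s` is connected, meets `t`, and no edge leads from `s ∩ t` to `s \ t`,
then `s ⊆ t`. -/
theorem SimpleGraph.subset_of_induce_connected {V : Type*} {G : SimpleGraph V} {s t : Set V}
    (hs : (G.induce s).Connected) {x : V} (hxs : x ∈ s) (hxt : x ∈ t)
    (hclosed : ∀ u ∈ s, ∀ v ∈ s, G.Adj u v → u ∈ t → v ∈ t) : s ⊆ t := by
  have walk_mem : ∀ {a b : s}, (G.induce s).Walk a b → (a : V) ∈ t → (b : V) ∈ t := by
    intro a b p
    induction p with
    | nil => exact id
    | cons hadj _ ih =>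
      exact fun ha => ih (hclosed _ (Subtype.coe_prop _) _ (Subtype.coe_prop _) hadj ha)
  intro y hy
  obtain ⟨p⟩ := hs.preconnected ⟨x, hxs⟩ ⟨y, hy⟩
  exact walk_mem p hxt

/-- Connected proper F-twins are disjoint. -/
theorem ftwin_connected_disjoint {V : Type*} (G : SimpleGraph V) (V1 V2 : Set V)
    (h : G.FTwins V1 V2) (hne : V1 ≠ V2)
    (h1 : (G.induce V1).Connected) (h2 : (G.induce V2).Connected) :
    V1 ∩ V2 = ∅ := by
  obtain ⟨φ, hbij, -, hN⟩ := h
  by_contra hinter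
  obtain ⟨x, hx1, hx2⟩ := Set.nonempty_iff_ne_empty.mpr hinter
  refine hne (Set.Subset.antisymm ?_ ?_)
  · refine SimpleGraph.subset_of_induce_connected h1 hx1 hx2 fun u _ v hv huv hu2 => ?_
    obtain ⟨w, hw, rfl⟩ := hbij.surjOn hu2
    by_contra hv2
    have hmem : v ∈ G.neighborSet w \ V1 := (hN w hw).symm ▸ ⟨huv, hv2⟩
    exact hmem.2 hv
  · refine SimpleGraph.subset_of_induce_connected h2 hx2 hx1 fun u _ v hv huv hu1 => ?_
    by_contra hv1
    have hmem : v ∈ G.neighborSet (φ u) \ V2 := hN u hu1 ▸ ⟨huv, hv1⟩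
    exact hmem.2 hv
end

section
/- Let G be a simple graph and let V1, V2 be vertex sets of induced subgraphs of G that are proper F-twins (F-twins with V1 ≠ V2) such that the subgraphs induced by V1 and by V2 are both connected. Then either (a) V1 and V2 are each the vertex set of a connected component of G, or (b) V1 and V2 lie in the same connected component of G and the distance in G between V1 and V2 (the minimum of d(u,v) over u ∈ V1, v ∈ V2) equals 2. In either case no vertex of V1 is adjacent in G to a vertex of V2. -/
/-- `W` is the vertex set of a connected component of `G`. -/
def SimpleGraph.IsCompSuppOfGraph {V : Type*} (G : SimpleGraph V) (W : Set V) : Prop :=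
  ∃ C : G.ConnectedComponent, W = C.supp

/-- A set that meets a connected vertex set and is closed under adjacency inside it
contains it. -/
theorem SimpleGraph.Preconnected.subset_of_adj_closed {V : Type*} {G : SimpleGraph V}
    {W S : Set V} (hW : (G.induce W).Preconnected) {x : V} (hxW : x ∈ W) (hxS : x ∈ S)
    (hS : ∀ a ∈ W, a ∈ S → ∀ b ∈ W, G.Adj a b → b ∈ S) : W ⊆ S := by
  intro y hy
  obtain ⟨p⟩ := hW ⟨x, hxW⟩ ⟨y, hy⟩
  by_contra hyS
  obtain ⟨d, -, hd₁, hd₂⟩ := p.exists_boundary_dart (Subtype.val ⁻¹' S) hxS hyS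
  exact hd₂ (hS _ d.fst.2 hd₁ _ d.snd.2 d.adj)

theorem SimpleGraph.Preconnected.reachable_of_induce {V : Type*} {G : SimpleGraph V}
    {W : Set V} (hW : (G.induce W).Preconnected) {x y : V} (hx : x ∈ W) (hy : y ∈ W) :
    G.Reachable x y :=
  (hW ⟨x, hx⟩ ⟨y, hy⟩).map (SimpleGraph.Embedding.induce W).toHom

theorem SimpleGraph.Connected.isCompSuppOfGraph {V : Type*} {G : SimpleGraph V} {W : Set V}
    (hW : (G.induce W).Connected) (hcl : ∀ a ∈ W, ∀ b, G.Adj a b → b ∈ W) :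
    G.IsCompSuppOfGraph W := by
  obtain ⟨⟨x, hx⟩⟩ := hW.nonempty
  refine ⟨G.connectedComponentMk x, Set.Subset.antisymm (fun y hy => ?_) (fun y hy => ?_)⟩
  · exact SimpleGraph.ConnectedComponent.sound (hW.preconnected.reachable_of_induce hy hx)
  · obtain ⟨p⟩ := (SimpleGraph.ConnectedComponent.exact hy).symm
    by_contra hyW
    obtain ⟨d, -, hd₁, hd₂⟩ := p.exists_boundary_dart W hx hyW
    exact hd₂ (hcl _ hd₁ _ d.adj)

/-- Connected proper F-twins `V1`, `V2` are either both vertex sets of connected components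
of `G`, or they lie in the same connected component of `G` and the distance between them
(the minimum of `d(u,v)` over `u ∈ V1`, `v ∈ V2`) equals `2`. In either case no vertex of
`V1` is adjacent to a vertex of `V2`. -/
theorem ftwin_connected_alternative {V : Type*} (G : SimpleGraph V) (V1 V2 : Set V)
    (h : G.FTwins V1 V2) (hne : V1 ≠ V2)
    (h1 : (G.induce V1).Connected) (h2 : (G.induce V2).Connected) :
    ((G.IsCompSuppOfGraph V1 ∧ G.IsCompSuppOfGraph V2) ∨
      ((∃ C : G.ConnectedComponent, ∀ x ∈ V1 ∪ V2, G.connectedComponentMk x = C) ∧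
        (∀ u ∈ V1, ∀ v ∈ V2, 2 ≤ G.dist u v) ∧
        (∃ u ∈ V1, ∃ v ∈ V2, G.dist u v = 2))) ∧
    (∀ u ∈ V1, ∀ v ∈ V2, ¬ G.Adj u v) := by
  obtain ⟨φ, hφ, -, hN⟩ := h
  have key : ∀ u ∈ V1, ∀ w, G.Adj u w ∧ w ∉ V1 ↔ G.Adj (φ u) w ∧ w ∉ V2 :=
    fun u hu w => Set.ext_iff.1 (hN u hu) w
  have hadj1 : ∀ u ∈ V1, ∀ v ∈ V2, G.Adj u v → v ∈ V1 := by
    intro u hu v hv huv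
    by_contra hv1
    exact ((key u hu v).1 ⟨huv, hv1⟩).2 hv
  have hadj2 : ∀ v ∈ V2, ∀ u ∈ V1, G.Adj v u → u ∈ V2 := by
    intro v hv u hu hvu
    obtain ⟨v', hv', rfl⟩ := hφ.surjOn hv
    by_contra hu2
    exact ((key v' hv' u).2 ⟨hvu, hu2⟩).2 hu
  have hdisj : ∀ x ∈ V1, x ∉ V2 := by
    intro x hx1 hx2
    exact hne (Set.Subset.antisymm
      (h1.preconnected.subset_of_adj_closed hx1 hx2 fun a _ ha b hb hab => hadj2 a ha b hb hab)
      (h2.preconnected.subset_of_adj_closed hx2 hx1 fun a _ ha b hb hab => hadj1 a ha b hb hab))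
  have hnadj : ∀ u ∈ V1, ∀ v ∈ V2, ¬ G.Adj u v :=
    fun u hu v hv huv => hdisj v (hadj1 u hu v hv huv) hv
  refine ⟨?_, hnadj⟩
  by_cases hout : ∃ u ∈ V1, ∃ w, G.Adj u w ∧ w ∉ V1
  · right
    obtain ⟨u, hu, w, hw⟩ := hout
    have hw' := (key u hu w).1 hw
    have hφu := hφ.mapsTo hu
    have hr : G.Reachable u (φ u) := hw.1.reachable.trans hw'.1.symm.reachable
    have hC : ∀ x ∈ V1 ∪ V2, G.Reachable x u := by
      rintro x (hx | hx)
      · exact h1.preconnected.reachable_of_induce hx hu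
      · exact (h2.preconnected.reachable_of_induce hx hφu).trans hr.symm
    have hdist : ∀ x ∈ V1, ∀ y ∈ V2, 2 ≤ G.dist x y := by
      intro x hx y hy
      have hxy : G.Reachable x y := (hC x (Or.inl hx)).trans (hC y (Or.inr hy)).symm
      have h0 : G.dist x y ≠ 0 := fun h => hdisj x hx (hxy.dist_eq_zero_iff.1 h ▸ hy)
      have h1 : G.dist x y ≠ 1 := fun h => hnadj x hx y hy (SimpleGraph.dist_eq_one_iff_adj.1 h)
      omega
    refine ⟨⟨G.connectedComponentMk u, fun x hx => SimpleGraph.ConnectedComponent.sound (hC x hx)⟩,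
      hdist, u, hu, φ u, hφu, le_antisymm ?_ (hdist u hu _ hφu)⟩
    exact SimpleGraph.dist_le (.cons hw.1 (.cons hw'.1.symm .nil))
  · left
    push Not at hout
    refine ⟨h1.isCompSuppOfGraph hout, h2.isCompSuppOfGraph fun v hv w hvw => ?_⟩
    obtain ⟨u, hu, rfl⟩ := hφ.surjOn hv
    by_contra hw
    have hw' := (key u hu w).2 ⟨hvw, hw⟩
    exact hw'.2 (hout u hu w hw'.1)
end

section
/- Let G be a simple graph and let V1, V2 be vertex sets of induced subgraphs of G that are F-twins via φ with V1 ∩ V2 = ∅. Let (u_0, u_1, …, u_k) be a path in G (the u_i are pairwise distinct and u_{i-1} is adjacent to u_i for 1 ≤ i ≤ k). Define v_i = φ(u_i) if u_i ∈ V1, v_i = φ^{-1}(u_i) if u_i ∈ V2, and v_i = u_i otherwise. Then (v_0, v_1, …, v_k) is also a path in G: the v_i are pairwise distinct and v_{i-1} is adjacent to v_i for 1 ≤ i ≤ k. -/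
/-- The mirror of a path under a pair of disjoint F-twins: given a path
`u 0, u 1, …, u k` in `G` and the map sending vertices of `V1` through `φ`,
vertices of `V2` through the inverse `ψ` of `φ`, and fixing all other vertices,
the image sequence `v 0, v 1, …, v k` is again a path in `G`. -/
theorem ftwin_mirror_path {V : Type*} (G : SimpleGraph V) (V1 V2 : Set V) (φ ψ : V → V)
    (h : G.IsFTwinVia V1 V2 φ)
    (hψ : Set.InvOn ψ φ V1 V2) (hψmaps : Set.MapsTo ψ V2 V1)
    (hdisj : V1 ∩ V2 = ∅)
    (k : ℕ) (u v : Fin (k + 1) → V)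
    (huinj : Function.Injective u)
    (hupath : ∀ i : Fin k, G.Adj (u i.castSucc) (u i.succ))
    (hv1 : ∀ i, u i ∈ V1 → v i = φ (u i))
    (hv2 : ∀ i, u i ∈ V2 → v i = ψ (u i))
    (hv3 : ∀ i, u i ∉ V1 ∪ V2 → v i = u i) :
    Function.Injective v ∧ ∀ i : Fin k, G.Adj (v i.castSucc) (v i.succ) := by
  obtain ⟨hbij, hiso, hnbr⟩ := h
  have hφ : ∀ x ∈ V1, φ x ∈ V2 := hbij.mapsTo
  have hψ' : ∀ x ∈ V2, ψ x ∈ V1 := hψmaps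
  have hψφ : ∀ x ∈ V1, ψ (φ x) = x := hψ.1
  have hφψ : ∀ x ∈ V2, φ (ψ x) = x := hψ.2
  have hnot : ∀ x ∈ V1, x ∉ V2 := fun x h1 h2 => (hdisj ▸ ⟨h1, h2⟩ : x ∈ (∅ : Set V))
  have hout : ∀ x ∈ V1, ∀ y, (G.Adj x y ∧ y ∉ V1 ↔ G.Adj (φ x) y ∧ y ∉ V2) :=
    fun x hx y => Set.ext_iff.mp (hnbr x hx) y
  have hv3' : ∀ i, u i ∉ V1 → u i ∉ V2 → v i = u i :=
    fun i h1 h2 => hv3 i fun h => h.elim h1 h2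
  constructor
  · intro i j hij
    apply huinj
    grind
  · intro i
    have hadj := hupath i
    by_cases a1 : u i.castSucc ∈ V1 <;> by_cases a2 : u i.castSucc ∈ V2 <;>
      by_cases b1 : u i.succ ∈ V1 <;> by_cases b2 : u i.succ ∈ V2 <;>
      grind [SimpleGraph.adj_comm]
end

section
/- Let G be a connected simple graph and let V1, V2 be vertex sets of induced subgraphs of G that are F-twins via φ with V1 ∩ V2 = ∅. Let u ∈ V1 and let ũ be any other vertex of G. Then: (a) if ũ ∈ V1, then d(u,ũ) = d(φ(u), φ(ũ)); (b) if ũ ∈ V2, then d(u,ũ) = d(φ(u), φ^{-1}(ũ)); (c) if ũ ∉ V1 ∪ V2, then d(u,ũ) = d(φ(u), ũ). -/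
/-- A graph homomorphism out of a connected graph does not increase distances. -/
theorem SimpleGraph.Connected.dist_hom_le {V W : Type*} {G : SimpleGraph V} {H : SimpleGraph W}
    (hG : G.Connected) (f : G →g H) (a b : V) : H.dist (f a) (f b) ≤ G.dist a b := by
  obtain ⟨p, hp⟩ := hG.exists_walk_length_eq_dist a b
  rw [← hp, ← SimpleGraph.Walk.length_map f p]
  exact SimpleGraph.dist_le _

/-- An involutive graph endomorphism of a connected graph preserves distances. -/
theorem SimpleGraph.Connected.dist_eq_of_involutive {V : Type*} {G : SimpleGraph V}
    (hG : G.Connected) (f : G →g G) (hf : Function.Involutive f) (a b : V) :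
    G.dist a b = G.dist (f a) (f b) := by
  refine le_antisymm ?_ (hG.dist_hom_le f a b)
  simpa only [hf a, hf b] using hG.dist_hom_le f (f a) (f b)

namespace SimpleGraph.IsFTwinVia

variable {V : Type*} {G : SimpleGraph V} {V1 V2 : Set V} {φ ψ : V → V}

/-- Disjoint F-twins have no edges between them. -/
theorem not_adj (h : G.IsFTwinVia V1 V2 φ) (hdisj : V1 ∩ V2 = ∅) {a b : V}
    (ha : a ∈ V1) (hb : b ∈ V2) : ¬ G.Adj a b := by
  intro hab
  have hb1 : b ∉ V1 := fun hb1 => (Set.eq_empty_iff_forall_notMem.mp hdisj b) ⟨hb1, hb⟩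
  have hmem : b ∈ G.neighborSet a \ V1 := ⟨hab, hb1⟩
  rw [h.2.2 a ha] at hmem
  exact hmem.2 hb

/-- Outside `V1 ∪ V2`, twin vertices have the same neighbors. -/
theorem adj_iff_of_notMem (h : G.IsFTwinVia V1 V2 φ) {a b : V}
    (ha : a ∈ V1) (hb1 : b ∉ V1) (hb2 : b ∉ V2) : G.Adj a b ↔ G.Adj (φ a) b := by
  have hmem := Set.ext_iff.mp (h.2.2 a ha) b
  simpa [hb1, hb2] using hmem

open Classical in
/-- The map exchanging two F-twins and fixing every other vertex. -/
noncomputable def swap (V1 V2 : Set V) (φ ψ : V → V) (x : V) : V :=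
  if x ∈ V1 then φ x else if x ∈ V2 then ψ x else x

theorem swap_of_mem_left {x : V} (hx : x ∈ V1) : swap V1 V2 φ ψ x = φ x := if_pos hx

theorem swap_of_mem_right (hdisj : V1 ∩ V2 = ∅) {x : V} (hx : x ∈ V2) :
    swap V1 V2 φ ψ x = ψ x := by
  have hx1 : x ∉ V1 := fun hx1 => (Set.eq_empty_iff_forall_notMem.mp hdisj x) ⟨hx1, hx⟩
  simp [swap, hx1, hx]

theorem swap_of_notMem {x : V} (hx1 : x ∉ V1) (hx2 : x ∉ V2) :
    swap V1 V2 φ ψ x = x := by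
  simp [swap, hx1, hx2]

theorem swap_involutive (h : G.IsFTwinVia V1 V2 φ) (hψ : Set.InvOn ψ φ V1 V2)
    (hψmaps : Set.MapsTo ψ V2 V1) (hdisj : V1 ∩ V2 = ∅) :
    Function.Involutive (swap V1 V2 φ ψ) := by
  intro x
  by_cases hx1 : x ∈ V1
  · rw [swap_of_mem_left hx1, swap_of_mem_right hdisj (h.1.mapsTo hx1), hψ.1 hx1]
  by_cases hx2 : x ∈ V2
  · rw [swap_of_mem_right hdisj hx2, swap_of_mem_left (hψmaps hx2), hψ.2 hx2]
  · rw [swap_of_notMem hx1 hx2, swap_of_notMem hx1 hx2]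

theorem adj_swap (h : G.IsFTwinVia V1 V2 φ) (hψ : Set.InvOn ψ φ V1 V2)
    (hψmaps : Set.MapsTo ψ V2 V1) (hdisj : V1 ∩ V2 = ∅) {a b : V} (hab : G.Adj a b) :
    G.Adj (swap V1 V2 φ ψ a) (swap V1 V2 φ ψ b) := by
  by_cases ha1 : a ∈ V1
  · rw [swap_of_mem_left ha1]
    by_cases hb1 : b ∈ V1
    · rw [swap_of_mem_left hb1]
      exact (h.2.1 a ha1 b hb1).mp hab
    by_cases hb2 : b ∈ V2
    · exact absurd hab (h.not_adj hdisj ha1 hb2)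
    · rw [swap_of_notMem hb1 hb2]
      exact (h.adj_iff_of_notMem ha1 hb1 hb2).mp hab
  by_cases ha2 : a ∈ V2
  · rw [swap_of_mem_right hdisj ha2]
    by_cases hb1 : b ∈ V1
    · exact absurd hab.symm (h.not_adj hdisj hb1 ha2)
    by_cases hb2 : b ∈ V2
    · rw [swap_of_mem_right hdisj hb2, h.2.1 _ (hψmaps ha2) _ (hψmaps hb2), hψ.2 ha2, hψ.2 hb2]
      exact hab
    · rw [swap_of_notMem hb1 hb2, h.adj_iff_of_notMem (hψmaps ha2) hb1 hb2, hψ.2 ha2]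
      exact hab
  rw [swap_of_notMem ha1 ha2]
  by_cases hb1 : b ∈ V1
  · rw [swap_of_mem_left hb1]
    exact ((h.adj_iff_of_notMem hb1 ha1 ha2).mp hab.symm).symm
  by_cases hb2 : b ∈ V2
  · rw [swap_of_mem_right hdisj hb2, G.adj_comm, h.adj_iff_of_notMem (hψmaps hb2) ha1 ha2,
      hψ.2 hb2]
    exact hab.symm
  · rwa [swap_of_notMem hb1 hb2]

theorem dist_swap (h : G.IsFTwinVia V1 V2 φ) (hG : G.Connected) (hψ : Set.InvOn ψ φ V1 V2)
    (hψmaps : Set.MapsTo ψ V2 V1) (hdisj : V1 ∩ V2 = ∅) (a b : V) :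
    G.dist a b = G.dist (swap V1 V2 φ ψ a) (swap V1 V2 φ ψ b) :=
  hG.dist_eq_of_involutive ⟨swap V1 V2 φ ψ, h.adj_swap hψ hψmaps hdisj⟩
    (h.swap_involutive hψ hψmaps hdisj) a b

end SimpleGraph.IsFTwinVia

/-- Distance identities for disjoint F-twins `V1`, `V2` (via `φ`, with inverse `ψ`) in a
connected graph: for `u ∈ V1` and any other vertex `w`, (a) if `w ∈ V1` then
`d(u,w) = d(φ u, φ w)`; (b) if `w ∈ V2` then `d(u,w) = d(φ u, ψ w)`; (c) if
`w ∉ V1 ∪ V2` then `d(u,w) = d(φ u, w)`. -/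
theorem ftwin_dist_identities {V : Type*} (G : SimpleGraph V) (hconn : G.Connected)
    (V1 V2 : Set V) (φ ψ : V → V)
    (h : G.IsFTwinVia V1 V2 φ)
    (hψ : Set.InvOn ψ φ V1 V2) (hψmaps : Set.MapsTo ψ V2 V1)
    (hdisj : V1 ∩ V2 = ∅)
    (u : V) (hu : u ∈ V1) (w : V) (hw : w ≠ u) :
    (w ∈ V1 → G.dist u w = G.dist (φ u) (φ w)) ∧
    (w ∈ V2 → G.dist u w = G.dist (φ u) (ψ w)) ∧
    (w ∉ V1 ∪ V2 → G.dist u w = G.dist (φ u) w) := by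
  have key := h.dist_swap hconn hψ hψmaps hdisj u w
  rw [SimpleGraph.IsFTwinVia.swap_of_mem_left hu] at key
  refine ⟨fun hw1 => ?_, fun hw2 => ?_, fun hw12 => ?_⟩
  · rwa [SimpleGraph.IsFTwinVia.swap_of_mem_left hw1] at key
  · rwa [SimpleGraph.IsFTwinVia.swap_of_mem_right hdisj hw2] at key
  · rwa [SimpleGraph.IsFTwinVia.swap_of_notMem (fun h1 => hw12 (Or.inl h1))
      (fun h2 => hw12 (Or.inr h2))] at key
end

section
/- Let G be a connected finite simple graph and let V1, V2 be vertex sets of induced subgraphs of G that are F-twins via φ with V1 ∩ V2 = ∅. Then V1 and V2 are homometric: the multiset of pairwise distances d(u,v) over all unordered pairs {u,v} of distinct vertices of V1 equals the multiset of pairwise distances over all unordered pairs of distinct vertices of V2. -/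
namespace SimpleGraph

variable {V : Type*} {G : SimpleGraph V}

theorem Connected.dist_map_le {W : Type*} {H : SimpleGraph W} (hG : G.Connected) (f : G →g H)
    (a b : V) : H.dist (f a) (f b) ≤ G.dist a b := by
  obtain ⟨p, hp⟩ := hG.exists_walk_length_eq_dist a b
  rw [← hp, ← p.length_map f]
  exact dist_le _

/-- Disjoint F-twins are exchanged by an involutive endomorphism of the graph. -/
theorem IsFTwinVia.exists_involutive_hom {V1 V2 : Set V} {φ : V → V}
    (h : G.IsFTwinVia V1 V2 φ) (hdisj : V1 ∩ V2 = ∅) :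
    ∃ f : G →g G, Function.Involutive f ∧ Set.EqOn f φ V1 := by
  classical
  obtain ⟨hφ, hadj, hnbr⟩ := h
  have hd : ∀ x ∈ V1, x ∉ V2 := fun x h1 h2 =>
    (Set.eq_empty_iff_forall_notMem.mp hdisj x) ⟨h1, h2⟩
  have hsurj : ∀ y ∈ V2, ∃ x ∈ V1, φ x = y := fun y hy => hφ.surjOn hy
  choose! ψ hψ hφψ using hsurj
  have hψφ : ∀ x ∈ V1, ψ (φ x) = x := fun x hx =>
    hφ.injOn (hψ _ (hφ.mapsTo hx)) hx (hφψ _ (hφ.mapsTo hx))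
  have hnbr' : ∀ u ∈ V1, ∀ w, (G.Adj u w ∧ w ∉ V1) ↔ (G.Adj (φ u) w ∧ w ∉ V2) :=
    fun u hu w => Set.ext_iff.mp (hnbr u hu) w
  have hm := hφ.mapsTo
  let f : V → V := fun x => if x ∈ V1 then φ x else if x ∈ V2 then ψ x else x
  have f_left : ∀ x ∈ V1, f x = φ x := fun x hx => if_pos hx
  have f_right : ∀ x ∈ V2, f x = ψ x := fun x hx => by
    simp only [f, if_neg fun h1 => hd x h1 hx, if_pos hx]
  have f_outside : ∀ x, x ∉ V1 → x ∉ V2 → f x = x := fun x h1 h2 => by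
    simp only [f, if_neg h1, if_neg h2]
  have f_adj_left : ∀ x ∈ V1, ∀ y, G.Adj x y → G.Adj (f x) (f y) := by
    intro x hx y hxy
    rw [f_left x hx]
    by_cases hy : y ∈ V1
    · rw [f_left y hy]
      exact (hadj x hx y hy).mp hxy
    · have hw := (hnbr' x hx y).mp ⟨hxy, hy⟩
      rw [f_outside y hy hw.2]
      exact hw.1
  have f_adj_right : ∀ x ∈ V2, ∀ y, G.Adj x y → G.Adj (f x) (f y) := by
    intro x hx y hxy
    rw [f_right x hx]
    by_cases hy : y ∈ V2
    · rw [f_right y hy, hadj _ (hψ x hx) _ (hψ y hy), hφψ x hx, hφψ y hy]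
      exact hxy
    · have hw := (hnbr' (ψ x) (hψ x hx) y).mpr ⟨by rwa [hφψ x hx], hy⟩
      rw [f_outside y hw.2 hy]
      exact hw.1
  have f_adj : ∀ x y, G.Adj x y → G.Adj (f x) (f y) := by
    intro x y hxy
    by_cases hx1 : x ∈ V1
    · exact f_adj_left x hx1 y hxy
    by_cases hx2 : x ∈ V2
    · exact f_adj_right x hx2 y hxy
    by_cases hy1 : y ∈ V1
    · exact (f_adj_left y hy1 x hxy.symm).symm
    by_cases hy2 : y ∈ V2
    · exact (f_adj_right y hy2 x hxy.symm).symm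
    rwa [f_outside x hx1 hx2, f_outside y hy1 hy2]
  refine ⟨⟨f, fun {x y} => f_adj x y⟩, fun x => ?_, f_left⟩
  change f (f x) = x
  by_cases hx1 : x ∈ V1
  · rw [f_left x hx1, f_right _ (hm hx1), hψφ x hx1]
  by_cases hx2 : x ∈ V2
  · rw [f_right x hx2, f_left _ (hψ x hx2), hφψ x hx2]
  rw [f_outside x hx1 hx2, f_outside x hx1 hx2]

/-- In a connected graph, the bijection between disjoint F-twins preserves distances. -/
theorem IsFTwinVia.dist_eq {V1 V2 : Set V} {φ : V → V} (h : G.IsFTwinVia V1 V2 φ)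
    (hdisj : V1 ∩ V2 = ∅) (hG : G.Connected) {a b : V} (ha : a ∈ V1) (hb : b ∈ V1) :
    G.dist (φ a) (φ b) = G.dist a b := by
  obtain ⟨f, hf, hfφ⟩ := h.exists_involutive_hom hdisj
  rw [← hfφ ha, ← hfφ hb]
  refine (hG.dist_map_le f a b).antisymm ?_
  simpa only [hf a, hf b] using hG.dist_map_le f (f a) (f b)

end SimpleGraph

/-- Disjoint F-twins in a connected finite graph are homometric: the multiset of pairwise
distances over unordered pairs of distinct vertices of `V1` equals that of `V2`. -/
theorem ftwin_homometric {V : Type*} [Fintype V] [DecidableEq V] (G : SimpleGraph V)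
    (hconn : G.Connected) (V1 V2 : Finset V) (φ : V → V)
    (h : G.IsFTwinVia ↑V1 ↑V2 φ) (hdisj : (↑V1 : Set V) ∩ ↑V2 = ∅) :
    ((V1.sym2.filter fun p => ¬ p.IsDiag).val.map
        (Sym2.lift ⟨fun a b => G.dist a b, fun a b => G.dist_comm⟩)) =
      ((V2.sym2.filter fun p => ¬ p.IsDiag).val.map
        (Sym2.lift ⟨fun a b => G.dist a b, fun a b => G.dist_comm⟩)) := by
  have hφ := h.1
  refine Multiset.map_eq_map_of_bij_of_nodup _ _ (Finset.nodup _) (Finset.nodup _)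
    (fun p _ => p.map φ) ?_ ?_ ?_ ?_
  · intro p hp
    induction p with
    | _ a b =>
      simp only [Finset.mem_val, Finset.mem_filter, Finset.mk_mem_sym2_iff, Sym2.map_mk,
        Sym2.mk_isDiag_iff] at hp ⊢
      exact ⟨⟨hφ.mapsTo hp.1.1, hφ.mapsTo hp.1.2⟩,
        fun hab => hp.2 (hφ.injOn hp.1.1 hp.1.2 hab)⟩
  · intro p hp q hq hpq
    induction p with
    | _ a b =>
    induction q with
    | _ c d =>
      simp only [Finset.mem_val, Finset.mem_filter, Finset.mk_mem_sym2_iff] at hp hq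
      simp only [Sym2.map_mk, Sym2.eq_iff] at hpq ⊢
      exact hpq.imp
        (And.imp (hφ.injOn hp.1.1 hq.1.1) (hφ.injOn hp.1.2 hq.1.2))
        (And.imp (hφ.injOn hp.1.1 hq.1.2) (hφ.injOn hp.1.2 hq.1.1))
  · intro q hq
    induction q with
    | _ c d =>
      simp only [Finset.mem_val, Finset.mem_filter, Finset.mk_mem_sym2_iff,
        Sym2.mk_isDiag_iff] at hq
      obtain ⟨a, ha, rfl⟩ := hφ.surjOn hq.1.1
      obtain ⟨b, hb, rfl⟩ := hφ.surjOn hq.1.2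
      refine ⟨s(a, b), ?_, Sym2.map_mk ..⟩
      simp only [Finset.mem_val, Finset.mem_filter, Finset.mk_mem_sym2_iff, Sym2.mk_isDiag_iff]
      exact ⟨⟨ha, hb⟩, fun hab => hq.2 (congrArg φ hab)⟩
  · intro p hp
    induction p with
    | _ a b =>
      simp only [Finset.mem_val, Finset.mem_filter, Finset.mk_mem_sym2_iff] at hp
      exact (h.dist_eq hdisj hconn hp.1.1 hp.1.2).symm
end

section
/- Let G be a simple graph, let u and u' be distinct vertices with N(u) = N(u') (proper false twin vertices), and let H ⊆ V(G) be a vertex set with u ∈ H, |H| ≥ 2, such that the subgraph induced by H is connected and H admits a proper F-twin (there is H' ≠ H with H and H' F-twins). Then u' ∈ H. -/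
/-- A connected induced subgraph has an edge leaving any vertex set that it meets
without being contained in it. -/
theorem SimpleGraph.exists_adj_mem_notMem_of_induce_connected {V : Type*} {G : SimpleGraph V}
    {H : Set V} (hconn : (G.induce H).Connected) (P : V → Prop) {x y : V}
    (hx : x ∈ H) (hy : y ∈ H) (hPx : P x) (hPy : ¬ P y) :
    ∃ a ∈ H, ∃ b ∈ H, G.Adj a b ∧ P a ∧ ¬ P b := by
  obtain ⟨p⟩ := hconn.preconnected ⟨x, hx⟩ ⟨y, hy⟩
  obtain ⟨d, -, h₁, h₂⟩ := p.exists_boundary_dart {v | P v} hPx hPy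
  exact ⟨d.fst, d.fst.2, d.snd, d.snd.2, d.adj, h₁, h₂⟩

/-- Intersecting F-twins, one of which is connected, are equal. -/
theorem SimpleGraph.FTwins.eq_of_connected {V : Type*} {G : SimpleGraph V} {H H' : Set V}
    (h : G.FTwins H H') (hconn : (G.induce H).Connected) {u : V} (hu : u ∈ H) (hu' : u ∈ H') :
    H' = H := by
  obtain ⟨φ, hbij, hadj, hout⟩ := h
  apply Set.Subset.antisymm
  · intro z hz
    by_contra hzH
    obtain ⟨s, hs, rfl⟩ := hbij.surjOn hu'
    obtain ⟨t, ht, rfl⟩ := hbij.surjOn hz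
    obtain ⟨a, ha, b, hb, hab, haH, hbH⟩ :=
      exists_adj_mem_notMem_of_induce_connected hconn (fun v => φ v ∈ H) hs ht hu hzH
    have hmem : φ b ∈ G.neighborSet (φ a) \ H := ⟨(hadj a ha b hb).1 hab, hbH⟩
    rw [hout _ haH] at hmem
    exact hmem.2 (hbij.mapsTo hb)
  · intro z hz
    by_contra hzH
    obtain ⟨a, -, b, hb, hab, haH, hbH⟩ :=
      exists_adj_mem_notMem_of_induce_connected hconn (· ∈ H') hu hz hu' hzH
    obtain ⟨v, hv, rfl⟩ := hbij.surjOn haH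
    have hmem : b ∈ G.neighborSet (φ v) \ H' := ⟨hab, hbH⟩
    rw [← hout v hv] at hmem
    exact hmem.2 hb

/-- If `u` and `u'` are proper false twin vertices and `u` is properly contained in a
connected vertex set `H` (with at least two vertices) admitting a proper F-twin, then
`u'` also belongs to `H`. -/
theorem false_twin_mem_of_ftwin {V : Type*} (G : SimpleGraph V) (u u' : V) (hne : u ≠ u')
    (htwin : G.neighborSet u = G.neighborSet u')
    (H : Set V) (huH : u ∈ H) (hH2 : H.Nontrivial)
    (hconn : (G.induce H).Connected)
    (hFT : ∃ H' : Set V, H' ≠ H ∧ G.FTwins H H') :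
    u' ∈ H := by
  by_contra hu'
  obtain ⟨H', hH', hFT⟩ := hFT
  refine hH' (hFT.eq_of_connected hconn huH ?_)
  obtain ⟨φ, -, -, hout⟩ := hFT
  obtain ⟨y, hy, hyu⟩ := hH2.exists_ne u
  obtain ⟨a, -, w, hw, haw, rfl, -⟩ :=
    SimpleGraph.exists_adj_mem_notMem_of_induce_connected hconn (· = u) huH hy rfl hyu
  have hwu' : u' ∈ G.neighborSet w \ H := ⟨(htwin ▸ haw : w ∈ G.neighborSet u').symm, hu'⟩
  rw [hout w hw] at hwu'
  have hφw : φ w ∈ G.neighborSet a := htwin ▸ hwu'.1.symm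
  by_contra ha
  have hmem : a ∈ G.neighborSet (φ w) \ H' := ⟨hφw.symm, ha⟩
  rw [← hout w hw] at hmem
  exact hmem.2 huH
end

section
/- Let G be a simple graph. Suppose u is a vertex admitting a proper false twin (there is u' ≠ u with N(u) = N(u')), and suppose {a,b} is an edge of G such that the vertex set {a,b} admits a proper F-twin (there is a two-element vertex set {a',b'} ≠ {a,b} inducing an edge such that {a,b} and {a',b'} are F-twins). Then u ∉ {a,b}. That is, the set of vertices admitting proper false twins and the set of vertices lying on edges admitting proper F-twins are disjoint. -/
/-- An endpoint `a` of an edge `ab` has no proper false twin when `ab` has the same outside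
neighborhoods, endpoint by endpoint, as a different edge `pq`. -/
theorem SimpleGraph.neighborSet_ne_of_edge_twins {V : Type*} {G : SimpleGraph V} {a b p q a' : V}
    (hab : G.Adj a b) (hpq : G.Adj p q) (hne : ({p, q} : Set V) ≠ {a, b})
    (ha : G.neighborSet a \ {a, b} = G.neighborSet p \ {p, q})
    (hb : G.neighborSet b \ {a, b} = G.neighborSet q \ {p, q}) (ha' : a' ≠ a) :
    G.neighborSet a ≠ G.neighborSet a' := by
  intro h
  have hadj (x : V) : G.Adj a x ↔ G.Adj a' x := Set.ext_iff.1 h x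
  have ha'b : a' ≠ b := ((hadj b).1 hab).ne
  have ha'q : a' ∈ G.neighborSet q \ {p, q} :=
    hb ▸ ⟨((hadj b).1 hab).symm, by simp [ha', ha'b]⟩
  have haq : G.Adj a q := (hadj q).2 ha'q.1.symm
  have hqb : q ≠ b := by
    rintro rfl
    have hpa : p ≠ a := by
      rintro rfl
      exact hne rfl
    have hp : p ∈ G.neighborSet q \ {p, q} := hb ▸ ⟨hpq.symm, by simp [hpa, hpq.ne]⟩
    exact hp.2 (by simp)
  have hq : q ∈ G.neighborSet p \ {p, q} := ha ▸ ⟨haq, by simp [haq.ne', hqb]⟩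
  exact hq.2 (by simp)

/-- Vertices admitting proper false twins and vertices lying on edges admitting proper
F-twins are disjoint: if `u` has a proper false twin and the edge `{a,b}` admits a proper
F-twin edge, then `u ∉ {a,b}`. -/
theorem false_twin_vertex_not_on_ftwin_edge {V : Type*} (G : SimpleGraph V)
    (u : V) (hu : ∃ u' : V, u' ≠ u ∧ G.neighborSet u = G.neighborSet u')
    (a b : V) (hab : G.Adj a b)
    (hFT : ∃ a' b' : V, G.Adj a' b' ∧ ({a', b'} : Set V) ≠ {a, b} ∧
      G.FTwins {a, b} {a', b'}) :
    u ≠ a ∧ u ≠ b := by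
  obtain ⟨u', hu', hN⟩ := hu
  obtain ⟨a', b', -, hne, φ, hbij, hadj, hout⟩ := hFT
  have himage : ({a', b'} : Set V) = {φ a, φ b} := by
    rw [← hbij.image_eq, Set.image_pair]
  rw [himage] at hne hout
  have hφ : G.Adj (φ a) (φ b) := (hadj a (by simp) b (by simp)).1 hab
  have ha := hout a (by simp)
  have hb := hout b (by simp)
  constructor
  · rintro rfl
    exact SimpleGraph.neighborSet_ne_of_edge_twins hab hφ hne ha hb hu' hN
  · rintro rfl
    rw [Set.pair_comm a u, Set.pair_comm (φ a)] at hne ha hb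
    exact SimpleGraph.neighborSet_ne_of_edge_twins hab.symm hφ.symm hne hb ha hu' hN
end

section
/- Let G be a simple graph and let u, v, w be distinct vertices with u adjacent to v and v adjacent to w. Suppose each of the two-element vertex sets {u,v} and {v,w} admits a proper F-twin (for each there is a distinct two-element vertex set which is its F-twin). Then G contains the 6-cycle C6 as an induced subgraph: there exist six pairwise distinct vertices x1, …, x6 of G such that xi is adjacent to xj if and only if |i−j| = 1 or {i,j} = {1,6}. -/
/-- A proper F-twin of an edge `{u, v}` is an edge `{a, b}`, disjoint from `{u, v}` and with no edges
to it, such that `u`, `a` and `v`, `b` have the same neighbors outside the two edges. -/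
theorem SimpleGraph.FTwins.exists_disjoint_twin_edge {V : Type*} {G : SimpleGraph V} {u v : V}
    (huv : G.Adj u v) {S : Set V} (hne : S ≠ {u, v}) (h : G.FTwins {u, v} S) :
    ∃ a b : V, G.Adj a b ∧ a ≠ u ∧ a ≠ v ∧ b ≠ u ∧ b ≠ v ∧
      ¬ G.Adj u a ∧ ¬ G.Adj u b ∧ ¬ G.Adj v a ∧ ¬ G.Adj v b ∧
      (∀ x, x ≠ v → x ≠ b → (G.Adj u x ↔ G.Adj a x)) ∧
      (∀ x, x ≠ u → x ≠ a → (G.Adj v x ↔ G.Adj b x)) := by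
  obtain ⟨φ, hbij, hiso, hnbr⟩ := h
  obtain rfl : {φ u, φ v} = S := by rw [← hbij.image_eq, Set.image_pair]
  have hab : G.Adj (φ u) (φ v) := (hiso u (by simp) v (by simp)).1 huv
  have hu : ∀ x, (G.Adj u x ∧ x ≠ u ∧ x ≠ v) ↔ (G.Adj (φ u) x ∧ x ≠ φ u ∧ x ≠ φ v) := by
    simpa [Set.ext_iff] using hnbr u (by simp)
  have hv : ∀ x, (G.Adj v x ∧ x ≠ u ∧ x ≠ v) ↔ (G.Adj (φ v) x ∧ x ≠ φ u ∧ x ≠ φ v) := by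
    simpa [Set.ext_iff] using hnbr v (by simp)
  have hsymm : ∀ x y, G.Adj x y → G.Adj y x := fun _ _ h => h.symm
  have hirrefl : ∀ x, ¬ G.Adj x x := fun _ => G.irrefl
  generalize φ u = a at *
  generalize φ v = b at *
  have hne' : ¬ (a = u ∧ b = v) ∧ ¬ (a = v ∧ b = u) :=
    ⟨fun h => hne (by rw [h.1, h.2]), fun h => hne (by rw [h.1, h.2, Set.pair_comm])⟩
  clear hne hbij hiso hnbr
  refine ⟨a, b, hab, ?_, ?_, ?_, ?_, ?_, ?_, ?_, ?_, ?_, ?_⟩ <;> grind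

/-- If two edges `{u,v}` and `{v,w}` sharing the vertex `v` each admit a proper F-twin,
then `G` contains an induced `6`-cycle. -/
theorem induced_six_cycle_of_ftwin_edges {V : Type*} (G : SimpleGraph V)
    (u v w : V) (huv : u ≠ v) (hvw : v ≠ w) (huw : u ≠ w)
    (hadj1 : G.Adj u v) (hadj2 : G.Adj v w)
    (h1 : ∃ a b : V, a ≠ b ∧ ({a, b} : Set V) ≠ {u, v} ∧ G.FTwins {u, v} {a, b})
    (h2 : ∃ a b : V, a ≠ b ∧ ({a, b} : Set V) ≠ {v, w} ∧ G.FTwins {v, w} {a, b}) :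
    ∃ x : Fin 6 → V, Function.Injective x ∧
      ∀ i j : Fin 6, G.Adj (x i) (x j) ↔
        (i.val + 1 = j.val ∨ j.val + 1 = i.val ∨
          (i.val = 0 ∧ j.val = 5) ∨ (i.val = 5 ∧ j.val = 0)) := by
  obtain ⟨_, _, -, hne₁, h₁⟩ := h1
  obtain ⟨_, _, -, hne₂, h₂⟩ := h2
  obtain ⟨a, b, hab, hau, hav, hbu, hbv, hua, hub, hva, hvb, hNu, hNv⟩ :=
    h₁.exists_disjoint_twin_edge hadj1 hne₁
  obtain ⟨c, d, hcd, hcv, hcw, hdv, hdw, hvc, hvd, hwc, hwd, hMv, hMw⟩ :=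
    h₂.exists_disjoint_twin_edge hadj2 hne₂
  have hsymm : ∀ x y, G.Adj x y ↔ G.Adj y x := G.adj_comm
  have hirrefl : ∀ x, ¬ G.Adj x x := fun _ => G.irrefl
  have huc : G.Adj u c := by grind
  have hwb : G.Adj w b := by grind
  have hac : G.Adj a c := by grind
  obtain rfl : a = d := by grind
  have huw' : ¬ G.Adj u w := by grind
  have hbc : ¬ G.Adj b c := by rwa [← hNv c huc.ne' hac.ne']
  clear h₁ h₂ hne₁ hne₂
  have := hab.ne
  have := huc.ne
  have := hac.ne
  have := hwb.ne
  have : b ≠ c := by grind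
  refine ⟨![u, v, w, b, a, c], ?_, ?_⟩
  · intro i j hij
    fin_cases i <;> fin_cases j <;> simp at hij ⊢ <;> grind
  · intro i j
    fin_cases i <;> fin_cases j <;> simp <;> grind
end

section
/- Let G be a simple graph and let V1, V2 be vertex sets of induced subgraphs of G that are T-twins. Then the three sets V1 ∩ V2, V1 \ V2 and V2 \ V1 are fully connected to each other in G: every vertex of any one of these sets is adjacent in G to every vertex of each of the other two sets. -/
/-- `V1` and `V2` (as vertex sets of induced subgraphs of `G`) are T-twins via the
bijection `φ : V1 → V2`: `φ` is an isomorphism of the induced subgraphs and every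
`u ∈ V1` satisfies `N(u) ∪ V1 = N(φ u) ∪ V2`. -/
def SimpleGraph.IsTTwinVia {V : Type*} (G : SimpleGraph V) (V1 V2 : Set V) (φ : V → V) : Prop :=
  Set.BijOn φ V1 V2 ∧
  (∀ u ∈ V1, ∀ v ∈ V1, (G.Adj u v ↔ G.Adj (φ u) (φ v))) ∧
  (∀ u ∈ V1, G.neighborSet u ∪ V1 = G.neighborSet (φ u) ∪ V2)

/-- `V1` and `V2` are T-twins. -/
def SimpleGraph.TTwins {V : Type*} (G : SimpleGraph V) (V1 V2 : Set V) : Prop :=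
  ∃ φ : V → V, G.IsTTwinVia V1 V2 φ

/-- If `V1` and `V2` are T-twins, then `V1 ∩ V2`, `V1 \ V2` and `V2 \ V1` are fully
connected to each other. -/
theorem ttwin_fully_connected {V : Type*} (G : SimpleGraph V) (V1 V2 : Set V)
    (h : G.TTwins V1 V2) :
    (∀ x ∈ V1 ∩ V2, ∀ y ∈ V1 \ V2, G.Adj x y) ∧
    (∀ x ∈ V1 ∩ V2, ∀ y ∈ V2 \ V1, G.Adj x y) ∧
    (∀ x ∈ V1 \ V2, ∀ y ∈ V2 \ V1, G.Adj x y) := by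
  obtain ⟨φ, hφ, -, hN⟩ := h
  have h_right : ∀ x ∈ V2, ∀ y ∈ V1 \ V2, G.Adj x y := by
    intro x hx y hy
    obtain ⟨u, hu, rfl⟩ := hφ.surjOn hx
    have hmem : y ∈ G.neighborSet (φ u) ∪ V2 := hN u hu ▸ Or.inr hy.1
    exact hmem.resolve_right hy.2
  have h_left : ∀ x ∈ V1, ∀ y ∈ V2 \ V1, G.Adj x y := by
    intro x hx y hy
    have hmem : y ∈ G.neighborSet x ∪ V1 := (hN x hx).symm ▸ Or.inr hy.1
    exact hmem.resolve_right hy.2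
  exact ⟨fun x hx => h_right x hx.2, fun x hx => h_left x hx.1, fun x hx => h_left x hx.1⟩
end
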